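/- Let p > 7 be a prime with binary expansion p = 2^{e_1} + 2^{e_2} + ⋯ + 2^{e_N} + 1, where N ≥ 2 and e_1 > e_2 > ⋯ > e_N > 0, and suppose e_1 − e_2 = 2. Then, as real numbers, (1 + 2·l(p))/2^{2 + l(p)} < (t(p) + 2·l(p) − 1)/p < (1/2 + l(p))/2^{l(p)}, where l(p) and t(p) are the length and tail of the sequence of lower halves of p. -/

import Mathlib

/-- The lower half of a positive integer: `lh m = ⌊m/2⌋`. -/
def lh (m : ℕ) : ℕ := m / 2

/-- The length of the sequence of lower halves of `n`: the least positive `i`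
such that the `i`-th iterate of `lh` at `n` lies in `{2, 3, 4}`. -/
noncomputable def lhLen (n : ℕ) : ℕ :=
  sInf {i : ℕ | 0 < i ∧ lh^[i] n ∈ ({2, 3, 4} : Set ℕ)}

/-- The tail of the sequence of lower halves of `n`: its last term. -/
noncomputable def lhTail (n : ℕ) : ℕ := lh^[lhLen n] n

theorem lh_iterate (i n : ℕ) : lh^[i] n = n / 2 ^ i := by
  induction i with
  | zero => simp
  | succ i ih => rw [Function.iterate_succ_apply', ih, lh, Nat.div_div_eq_div_mul, pow_succ]

/-- A sum of strictly decreasing powers of two falls short of the next power of two after its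
leading term by at least its last term. -/
theorem sum_two_pow_add_two_pow_le (e : ℕ → ℕ) (n : ℕ) (he : ∀ i < n, e (i + 1) < e i) :
    ∑ i ∈ Finset.range (n + 1), 2 ^ e i + 2 ^ e n ≤ 2 ^ (e 0 + 1) := by
  induction n with
  | zero => simp [pow_succ, mul_two]
  | succ n ih =>
    have hstep : 2 ^ (e (n + 1) + 1) ≤ 2 ^ e n :=
      Nat.pow_le_pow_right two_pos (he n n.lt_succ_self)
    have := ih fun i hi => he i (by omega)
    rw [Finset.sum_range_succ]
    omega

theorem lh_iterate_eq_two_of_mem_Ico {n a : ℕ} (hn : 5 * 2 ^ a ≤ n) (hn' : n < 6 * 2 ^ a) :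
    lh^[a + 1] n = 2 := by
  rw [lh_iterate]
  exact Nat.div_eq_of_lt_le (by rw [pow_succ]; omega) (by rw [pow_succ]; omega)

theorem lhLen_eq_of_mem_Ico {n a : ℕ} (hn : 5 * 2 ^ a ≤ n) (hn' : n < 6 * 2 ^ a) :
    lhLen n = a + 1 := by
  apply IsLeast.csInf_eq
  refine ⟨⟨a.succ_pos, ?_⟩, ?_⟩
  · simp [lh_iterate_eq_two_of_mem_Ico hn hn']
  · rintro i ⟨-, hi⟩
    by_contra! hia
    have hpow : 2 ^ i ≤ 2 ^ a := Nat.pow_le_pow_right two_pos (by omega)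
    have h5 : 5 ≤ n / 2 ^ i := (Nat.le_div_iff_mul_le (by positivity)).2 (by omega)
    rw [lh_iterate] at hi
    simp only [Set.mem_insert_iff, Set.mem_singleton_iff] at hi
    omega

theorem lhTail_eq_of_mem_Ico {n a : ℕ} (hn : 5 * 2 ^ a ≤ n) (hn' : n < 6 * 2 ^ a) :
    lhTail n = 2 := by
  rw [lhTail, lhLen_eq_of_mem_Ico hn hn', lh_iterate_eq_two_of_mem_Ico hn hn']

theorem ratio_bounds_of_gap_two (p N : ℕ) (e : ℕ → ℕ) (hp : p.Prime) (h7 : 7 < p)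
    (hN : 2 ≤ N)
    (hanti : ∀ i j : ℕ, i < j → j < N → e j < e i)
    (hpos : ∀ i : ℕ, i < N → 0 < e i)
    (hexp : p = (∑ i ∈ Finset.range N, 2 ^ e i) + 1)
    (hgap : e 0 = e 1 + 2) :
    (1 + 2 * (lhLen p : ℝ)) / 2 ^ (2 + lhLen p)
        < ((lhTail p : ℝ) + 2 * (lhLen p : ℝ) - 1) / (p : ℝ) ∧
      ((lhTail p : ℝ) + 2 * (lhLen p : ℝ) - 1) / (p : ℝ)
        < (1 / 2 + (lhLen p : ℝ)) / 2 ^ (lhLen p) := by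
  obtain ⟨n, rfl⟩ : ∃ n, N = n + 2 := ⟨N - 2, by omega⟩
  have hsum := sum_two_pow_add_two_pow_le (fun i => e (i + 1)) n
    fun i hi => hanti _ _ (by omega) (by omega)
  have hlast : 2 ^ 1 ≤ 2 ^ e (n + 1) := Nat.pow_le_pow_right two_pos (hpos _ (by omega))
  have hlead : 2 ^ e 1 ≤ ∑ i ∈ Finset.range (n + 1), 2 ^ e (i + 1) :=
    Finset.single_le_sum (f := fun i => 2 ^ e (i + 1)) (fun _ _ => Nat.zero_le _)
      (Finset.mem_range.2 n.succ_pos)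
  rw [Finset.sum_range_succ', hgap, pow_add] at hexp
  simp only [zero_add, pow_succ] at hsum
  have hlb : 5 * 2 ^ e 1 ≤ p := by omega
  have hub : p < 6 * 2 ^ e 1 := by omega
  rw [lhTail_eq_of_mem_Ico hlb hub, lhLen_eq_of_mem_Ico hlb hub]
  have hlb' : (5 * 2 ^ e 1 : ℝ) ≤ p := by exact_mod_cast hlb
  have hub' : (p : ℝ) < 6 * 2 ^ e 1 := by exact_mod_cast hub
  have hpow : (0 : ℝ) < 2 ^ e 1 := by positivity
  have hp0 : (0 : ℝ) < p := by linarith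
  have hnum : (0 : ℝ) < 1 + 2 * ((e 1 + 1 : ℕ) : ℝ) := by positivity
  generalize ((e 1 + 1 : ℕ) : ℝ) = l at hnum ⊢
  have htwo : (2 : ℕ) + 2 * l - 1 = 1 + 2 * l := by push_cast; ring
  have hhalf : (1 / 2 + l) / 2 ^ (e 1 + 1) = (1 + 2 * l) / 2 ^ (e 1 + 2) := by
    rw [pow_succ _ (e 1 + 1)]
    field_simp
  rw [htwo, hhalf]
  constructor <;> apply div_lt_div_of_pos_left hnum
  · exact hp0
  · rw [show 2 + (e 1 + 1) = e 1 + 3 by ring, pow_add]; linarith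
  · positivity
  · rw [pow_add]; linarith
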